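/- (Matrix-valued case of Lemma 4.2, n = 1.) There exists a constant C > 0 such that for every positive definite Hermitian matrix Y ∈ Mat₂(ℂ) the matrix-valued function p⃗ ↦ e^{−Tr(P†Y)} · P† / (2|p⃗|) (with p₀ := |p⃗|) is entrywise integrable on ℝ³ and satisfies the matrix identity ∫_{ℝ³} e^{−Tr(P†Y)} · P† · d³p⃗/(2|p⃗|) = C · (det Y)⁻¹ · Y⁻¹. -/

import Mathlib

open Matrix MeasureTheory
open scoped ComplexOrder

/-- The Hermitian matrix `P† = (1/2)[[p₀−p₃, −p₁+ip₂],[−p₁−ip₂, p₀+p₃]]` of a point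
`p⃗ ∈ ℝ³` of the mantle of the forward light cone, with `p₀ := |p⃗|`. -/
noncomputable def Pd (q : EuclideanSpace ℝ (Fin 3)) : Matrix (Fin 2) (Fin 2) ℂ :=
  (1 / 2 : ℂ) •
    !![((‖q‖ - q 2 : ℝ) : ℂ), -(q 0 : ℂ) + (q 1 : ℂ) * Complex.I;
       -(q 0 : ℂ) - (q 1 : ℂ) * Complex.I, ((‖q‖ + q 2 : ℝ) : ℂ)]

open Real in
/-- The Gaussian integral with a linear term, as a lower Lebesgue integral. -/
theorem lintegral_exp_neg_mul_sq_add_mul {p : ℝ} (hp : 0 < p) (b : ℝ) :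
    ∫⁻ x : ℝ, ENNReal.ofReal (exp (-p * x ^ 2 + b * x)) =
      ENNReal.ofReal (√(π / p) * exp (b ^ 2 / (4 * p))) := by
  have key : ∀ x : ℝ, ENNReal.ofReal (exp (-p * x ^ 2 + b * x)) =
      ENNReal.ofReal (exp (-p * (x - b / (2 * p)) ^ 2)) *
        ENNReal.ofReal (exp (b ^ 2 / (4 * p))) := fun x => by
    rw [← ENNReal.ofReal_mul (exp_nonneg _), ← exp_add]
    congr 2
    field_simp
    ring
  simp_rw [key]
  rw [lintegral_mul_const _ (by fun_prop),
    lintegral_sub_right_eq_self (fun x => ENNReal.ofReal (exp (-p * x ^ 2))),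
    ← ofReal_integral_eq_lintegral_ofReal (integrable_exp_neg_mul_sq hp)
      (Filter.Eventually.of_forall fun x => exp_nonneg _),
    integral_gaussian, ENNReal.ofReal_mul (sqrt_nonneg _)]

/-- Lower Lebesgue integrals over three-dimensional Euclidean space as iterated integrals over
the coordinates. -/
theorem EuclideanSpace.lintegral_fin_three {f : ℝ × ℝ × ℝ → ENNReal} (hf : Measurable f) :
    ∫⁻ q : EuclideanSpace ℝ (Fin 3), f (q 0, q 1, q 2) = ∫⁻ x, ∫⁻ y, ∫⁻ z, f (x, y, z) := by
  have h1 := EuclideanSpace.volume_preserving_symm_measurableEquiv_toLp (Fin 3)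
  have h2 := volume_preserving_piFinSuccAbove (fun _ : Fin 3 => ℝ) 0
  have h3 := volume_preserving_piFinTwo (fun _ : Fin 2 => ℝ)
  have h := (((MeasurePreserving.id (volume : Measure ℝ)).prod h3).comp h2).comp h1
  have e : (fun q : EuclideanSpace ℝ (Fin 3) => f (q 0, q 1, q 2)) = fun q => f
      (((Prod.map id (MeasurableEquiv.piFinTwo fun _ : Fin 2 => ℝ)) ∘
        (MeasurableEquiv.piFinSuccAbove (fun _ : Fin 3 => ℝ) 0)) ∘
        (MeasurableEquiv.toLp 2 (Fin 3 → ℝ)).symm <| q) := rfl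
  rw [e, h.lintegral_comp hf, lintegral_prod _ hf.aemeasurable]
  refine lintegral_congr fun x => ?_
  exact lintegral_prod _ (by fun_prop)

open Real in
/-- The light-cone substitution `s = √(c + z²) + z`, under which
`dz / √(c + z²) = ds / s`. -/
theorem lintegral_lightcone_substitution {c : ℝ} (hc : 0 < c) (a d k : ℝ) :
    ∫⁻ z : ℝ, ENNReal.ofReal (exp (-(a * (√(c + z ^ 2) - z) + d * (√(c + z ^ 2) + z)) / 2 + k) /
        (2 * √(c + z ^ 2))) =
      ∫⁻ s in Set.Ioi (0 : ℝ), ENNReal.ofReal (exp (-(a * (c / s) + d * s) / 2 + k) / (2 * s)) := by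
  let φ : ℝ → ℝ := fun s => (s - c / s) / 2
  have hsq : ∀ s : ℝ, 0 < s → √(c + φ s ^ 2) = (s + c / s) / 2 := fun s hs => by
    rw [sqrt_eq_iff_mul_self_eq_of_pos (by positivity)]
    simp only [φ]
    field_simp
    ring
  have hinj : Set.InjOn φ (Set.Ioi 0) := fun s hs t ht h => by
    have h1 : s = √(c + φ s ^ 2) + φ s := by rw [hsq s hs]; simp only [φ]; ring
    have h2 : t = √(c + φ t ^ 2) + φ t := by rw [hsq t ht]; simp only [φ]; ring
    rw [h1, h2, h]
  have himg : φ '' Set.Ioi 0 = Set.univ := by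
    refine Set.eq_univ_of_forall fun z => ⟨√(c + z ^ 2) + z, ?_, ?_⟩
    · have : |z| < √(c + z ^ 2) := by
        rw [← sqrt_sq_eq_abs]
        exact sqrt_lt_sqrt (sq_nonneg z) (by linarith)
      have := neg_abs_le z
      simp only [Set.mem_Ioi]
      linarith
    · have h1 : √(c + z ^ 2) ^ 2 = c + z ^ 2 := sq_sqrt (by positivity)
      have h2 : √(c + z ^ 2) + z ≠ 0 := fun h0 => by
        rw [show √(c + z ^ 2) = -z by linarith] at h1
        linarith [neg_sq z]
      simp only [φ]
      field_simp
      linear_combination h1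
  have hder : ∀ s ∈ Set.Ioi (0 : ℝ),
      HasDerivWithinAt φ ((1 + c / s ^ 2) / 2) (Set.Ioi 0) s := fun s hs => by
    have hs0 : s ≠ 0 := (Set.mem_Ioi.mp hs).ne'
    have h := ((hasDerivAt_id s).sub ((hasDerivAt_inv hs0).const_mul c)).div_const 2
    refine (h.congr_deriv ?_).hasDerivWithinAt
    ring
  rw [← setLIntegral_univ, ← himg,
    lintegral_image_eq_lintegral_abs_deriv_mul measurableSet_Ioi hder hinj]
  refine setLIntegral_congr_fun measurableSet_Ioi fun s hs => ?_
  have hs : 0 < s := hs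
  rw [hsq s hs, abs_of_pos (by positivity), ← ENNReal.ofReal_mul (by positivity),
    show (s + c / s) / 2 - φ s = c / s by simp only [φ]; ring,
    show (s + c / s) / 2 + φ s = s by simp only [φ]; ring]
  congr 1
  field_simp

open Real in
/-- The Laplace transform of the invariant measure on the light cone, in coordinates. -/
theorem lintegral_lightcone {a d b g : ℝ} (ha : 0 < a) (hD : 0 < a * d - b ^ 2 - g ^ 2) :
    ∫⁻ x : ℝ, ∫⁻ y : ℝ, ∫⁻ z : ℝ, ENNReal.ofReal (exp (-(a * (√(x ^ 2 + y ^ 2 + z ^ 2) - z) +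
        d * (√(x ^ 2 + y ^ 2 + z ^ 2) + z)) / 2 + (b * x + g * y)) /
        (2 * √(x ^ 2 + y ^ 2 + z ^ 2))) =
      ENNReal.ofReal (2 * π / (a * d - b ^ 2 - g ^ 2)) := by
  let F : ℝ → ℝ → ℝ → ENNReal := fun x y s => ENNReal.ofReal
    (exp (-(a * ((x ^ 2 + y ^ 2) / s) + d * s) / 2 + (b * x + g * y)) / (2 * s))
  have hF : ∀ s ∈ Set.Ioi (0 : ℝ), ∫⁻ x : ℝ, ∫⁻ y : ℝ, F x y s =
      ENNReal.ofReal (π / a * exp (-((a * d - b ^ 2 - g ^ 2) / (2 * a)) * s)) := fun s hs => by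
    have hs : 0 < s := hs
    have hp : 0 < a / (2 * s) := by positivity
    have e : ∀ x y, F x y s = ENNReal.ofReal (exp (-(d * s) / 2) / (2 * s)) *
        (ENNReal.ofReal (exp (-(a / (2 * s)) * x ^ 2 + b * x)) *
          ENNReal.ofReal (exp (-(a / (2 * s)) * y ^ 2 + g * y))) := fun x y => by
      rw [← ENNReal.ofReal_mul (exp_nonneg _), ← ENNReal.ofReal_mul (by positivity), ← exp_add,
        div_mul_eq_mul_div, ← exp_add]
      simp only [F]
      congr 3
      field_simp
      ring
    simp_rw [e]
    simp_rw [lintegral_const_mul' _ _ ENNReal.ofReal_ne_top, lintegral_exp_neg_mul_sq_add_mul hp]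
    rw [lintegral_mul_const _ (by fun_prop), lintegral_exp_neg_mul_sq_add_mul hp,
      ← ENNReal.ofReal_mul (by positivity), ← ENNReal.ofReal_mul (by positivity)]
    congr 1
    calc _ = (√(π / (a / (2 * s))) * √(π / (a / (2 * s)))) / (2 * s) *
          (exp (-(d * s) / 2) * (exp (b ^ 2 / (4 * (a / (2 * s)))) *
            exp (g ^ 2 / (4 * (a / (2 * s)))))) := by ring
      _ = _ := by
        rw [mul_self_sqrt (by positivity), ← exp_add, ← exp_add]
        congr 1
        · field_simp
        · congr 1
          field_simp
          ring
  have hne : ∀ᵐ x : ℝ, x ≠ 0 := by simp [ae_iff]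
  calc _ = ∫⁻ x : ℝ, ∫⁻ y : ℝ, ∫⁻ s in Set.Ioi (0 : ℝ), F x y s := by
        refine lintegral_congr_ae (hne.mono fun x hx => lintegral_congr fun y => ?_)
        exact lintegral_lightcone_substitution (by positivity) a d _
    _ = ∫⁻ s in Set.Ioi (0 : ℝ), ∫⁻ x : ℝ, ∫⁻ y : ℝ, F x y s := by
        have : ∀ x : ℝ, ∫⁻ y : ℝ, ∫⁻ s in Set.Ioi (0 : ℝ), F x y s =
            ∫⁻ s in Set.Ioi (0 : ℝ), ∫⁻ y : ℝ, F x y s := fun x =>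
          lintegral_lintegral_swap (by simp only [F, Function.uncurry_def]; fun_prop)
        simp_rw [this]
        refine lintegral_lintegral_swap (Measurable.aemeasurable ?_)
        refine Measurable.lintegral_prod_right'
          (f := fun w : (ℝ × ℝ) × ℝ => F w.1.1 w.2 w.1.2) ?_
        simp only [F]
        fun_prop
    _ = ∫⁻ s in Set.Ioi (0 : ℝ),
          ENNReal.ofReal (π / a * exp (-((a * d - b ^ 2 - g ^ 2) / (2 * a)) * s)) :=
        setLIntegral_congr_fun measurableSet_Ioi hF
    _ = _ := by
        have hneg : -((a * d - b ^ 2 - g ^ 2) / (2 * a)) < 0 := neg_neg_of_pos (by positivity)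
        rw [← ofReal_integral_eq_lintegral_ofReal ((integrableOn_exp_mul_Ioi hneg 0).const_mul _)
          (Filter.Eventually.of_forall fun s => by positivity), integral_const_mul,
          integral_exp_mul_Ioi hneg]
        congr 1
        simp only [mul_zero, exp_zero]
        field_simp

/-- The phase `-Tr(P†Y)` for the Hermitian matrix `Y = [[a, b - ig], [b + ig, d]]`. -/
noncomputable def lightconePhase (a d b g : ℝ) (q : EuclideanSpace ℝ (Fin 3)) : ℝ :=
  -(a * (‖q‖ - q 2) + d * (‖q‖ + q 2)) / 2 + (b * q 0 + g * q 1)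

@[fun_prop]
theorem measurable_lightconePhase (a d b g : ℝ) : Measurable (lightconePhase a d b g) := by
  unfold lightconePhase
  fun_prop

open Real in
theorem lintegral_exp_lightconePhase {a d b g : ℝ} (ha : 0 < a)
    (hD : 0 < a * d - b ^ 2 - g ^ 2) :
    ∫⁻ q, ENNReal.ofReal (exp (lightconePhase a d b g q) / (2 * ‖q‖)) =
      ENNReal.ofReal (2 * π / (a * d - b ^ 2 - g ^ 2)) := by
  rw [← lintegral_lightcone ha hD, ← EuclideanSpace.lintegral_fin_three
    (f := fun w => ENNReal.ofReal (exp (-(a * (√(w.1 ^ 2 + w.2.1 ^ 2 + w.2.2 ^ 2) - w.2.2) +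
        d * (√(w.1 ^ 2 + w.2.1 ^ 2 + w.2.2 ^ 2) + w.2.2)) / 2 + (b * w.1 + g * w.2.1)) /
        (2 * √(w.1 ^ 2 + w.2.1 ^ 2 + w.2.2 ^ 2)))) (by fun_prop)]
  refine lintegral_congr fun q => ?_
  simp [lightconePhase, EuclideanSpace.norm_eq, Fin.sum_univ_three]

open Real in
theorem integrable_exp_lightconePhase {a d b g : ℝ} (ha : 0 < a)
    (hD : 0 < a * d - b ^ 2 - g ^ 2) :
    Integrable fun q => exp (lightconePhase a d b g q) / (2 * ‖q‖) :=
  (lintegral_ofReal_ne_top_iff_integrable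
    (Measurable.aestronglyMeasurable (by fun_prop))
    (Filter.Eventually.of_forall fun q => by positivity)).mp
    (lintegral_exp_lightconePhase ha hD ▸ ENNReal.ofReal_ne_top)

open Real in
theorem integral_exp_lightconePhase {a d b g : ℝ} (ha : 0 < a)
    (hD : 0 < a * d - b ^ 2 - g ^ 2) :
    ∫ q, exp (lightconePhase a d b g q) / (2 * ‖q‖) = 2 * π / (a * d - b ^ 2 - g ^ 2) := by
  rw [integral_eq_lintegral_of_nonneg_ae (Filter.Eventually.of_forall fun q => by positivity)
    (Measurable.aestronglyMeasurable (by fun_prop)), lintegral_exp_lightconePhase ha hD,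
    ENNReal.toReal_ofReal (by positivity)]

open Real ProbabilityTheory in
/-- The first moments of the Laplace transform, obtained by differentiating it in the direction
`(a₁, d₁, b₁, g₁)`. -/
theorem lightconePhase_mul_exp {a d b g : ℝ} (ha : 0 < a)
    (hD : 0 < a * d - b ^ 2 - g ^ 2) (a₁ d₁ b₁ g₁ : ℝ) :
    Integrable (fun q => exp (lightconePhase a d b g q) / (2 * ‖q‖) *
        lightconePhase a₁ d₁ b₁ g₁ q) ∧
      ∫ q, exp (lightconePhase a d b g q) / (2 * ‖q‖) * lightconePhase a₁ d₁ b₁ g₁ q =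
        -(2 * π * (a₁ * d + a * d₁ - 2 * b * b₁ - 2 * g * g₁)) /
          (a * d - b ^ 2 - g ^ 2) ^ 2 := by
  let w : EuclideanSpace ℝ (Fin 3) → ℝ := fun q => exp (lightconePhase a d b g q) / (2 * ‖q‖)
  have hw0 : ∀ q, 0 ≤ w q := fun q => by positivity
  have hwm : Measurable fun q => ENNReal.ofReal (w q) := by fun_prop
  have hlt : ∀ᵐ q : EuclideanSpace ℝ (Fin 3), ENNReal.ofReal (w q) < ⊤ :=
    Filter.Eventually.of_forall fun q => ENNReal.ofReal_lt_top
  let ν : Measure (EuclideanSpace ℝ (Fin 3)) := volume.withDensity fun q => ENNReal.ofReal (w q)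
  let X := lightconePhase a₁ d₁ b₁ g₁
  have hνint : ∀ f : EuclideanSpace ℝ (Fin 3) → ℝ,
      Integrable f ν ↔ Integrable fun q => w q * f q := fun f => by
    rw [integrable_withDensity_iff_integrable_smul' hwm hlt]
    simp only [ENNReal.toReal_ofReal (hw0 _), smul_eq_mul]
  have hνval : ∀ f : EuclideanSpace ℝ (Fin 3) → ℝ, ∫ q, f q ∂ν = ∫ q, w q * f q := fun f => by
    rw [integral_withDensity_eq_integral_toReal_smul hwm hlt]
    simp only [ENNReal.toReal_ofReal (hw0 _), smul_eq_mul]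
  have hshift : ∀ t : ℝ, (fun q => w q * exp (t * X q)) = fun q =>
      exp (lightconePhase (a + t * a₁) (d + t * d₁) (b + t * b₁) (g + t * g₁) q) / (2 * ‖q‖) :=
    fun t => by
      funext q
      simp only [w, X]
      rw [div_mul_eq_mul_div, ← exp_add]
      congr 2
      simp only [lightconePhase]
      ring
  let D : ℝ → ℝ := fun t =>
    (a + t * a₁) * (d + t * d₁) - (b + t * b₁) ^ 2 - (g + t * g₁) ^ 2
  have hev : ∀ᶠ t in nhds (0 : ℝ), 0 < a + t * a₁ ∧ 0 < D t := by
    have h1 : ContinuousAt (fun t : ℝ => a + t * a₁) 0 := by fun_prop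
    have h2 : ContinuousAt D 0 := by fun_prop
    exact (h1.eventually_const_lt (by simpa using ha)).and
      (h2.eventually_const_lt (by simpa [D] using hD))
  have hmem : (0 : ℝ) ∈ interior (integrableExpSet X ν) := by
    rw [mem_interior_iff_mem_nhds]
    refine hev.mono fun t ht => ?_
    change Integrable (fun q => exp (t * X q)) ν
    rw [hνint, hshift]
    exact integrable_exp_lightconePhase ht.1 ht.2
  have hmgf : mgf X ν =ᶠ[nhds 0] fun t => 2 * π / D t := hev.mono fun t ht => by
    change ∫ q, exp (t * X q) ∂ν = _
    rw [hνval, hshift]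
    exact integral_exp_lightconePhase ht.1 ht.2
  have hDder : HasDerivAt D (a₁ * d + a * d₁ - 2 * b * b₁ - 2 * g * g₁) 0 := by
    have lin : ∀ u u' : ℝ, HasDerivAt (fun t : ℝ => u + t * u') u' 0 := fun u u' => by
      simpa using ((hasDerivAt_id (0 : ℝ)).mul_const u').const_add u
    have h := (((lin a a₁).mul (lin d d₁)).sub ((lin b b₁).pow 2)).sub ((lin g g₁).pow 2)
    refine h.congr_deriv ?_
    simp
  have hD0 : D 0 = a * d - b ^ 2 - g ^ 2 := by simp [D]
  have hder := (hasDerivAt_const (0 : ℝ) (2 * π)).div hDder (by rw [hD0]; exact hD.ne')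
  have hder' := (hasDerivAt_mgf hmem).congr_of_eventuallyEq hmgf.symm
  constructor
  · have h := integrable_pow_mul_exp_of_mem_interior_integrableExpSet hmem 1
    rw [hνint] at h
    simpa using h
  · have h := hder'.unique hder
    rw [hνval] at h
    simp only [zero_mul, exp_zero, mul_one, hD0, zero_sub] at h
    exact h

/-- A positive definite Hermitian `2 × 2` matrix in terms of its four real coordinates. -/
theorem Matrix.PosDef.exists_eq_fin_two {Y : Matrix (Fin 2) (Fin 2) ℂ} (hY : Y.PosDef) :
    ∃ a d b g : ℝ, 0 < a ∧ 0 < a * d - b ^ 2 - g ^ 2 ∧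
      Y = !![(a : ℂ), b - g * Complex.I; b + g * Complex.I, d] := by
  have h00 := hY.isHermitian.apply 0 0
  have h11 := hY.isHermitian.apply 1 1
  have h10 := hY.isHermitian.apply 1 0
  have hY' : Y = !![((Y 0 0).re : ℂ), (Y 0 1).re - (-(Y 0 1).im : ℝ) * Complex.I;
      (Y 0 1).re + (-(Y 0 1).im : ℝ) * Complex.I, ((Y 1 1).re : ℂ)] := by
    ext i j
    fin_cases i <;> fin_cases j
    · exact (Complex.conj_eq_iff_re.mp h00).symm
    · apply Complex.ext <;> simp
    · change Y 1 0 = _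
      rw [← h10]
      apply Complex.ext <;> simp
    · exact (Complex.conj_eq_iff_re.mp h11).symm
  refine ⟨_, _, _, _, (Complex.pos_iff.mp (hY.diag_pos (i := 0))).1, ?_, hY'⟩
  have h := (Complex.pos_iff.mp hY.det_pos).1
  rw [hY', Matrix.det_fin_two_of] at h
  simp at h
  linarith

theorem neg_trace_Pd_mul (a d b g : ℝ) (q : EuclideanSpace ℝ (Fin 3)) :
    -(Pd q * !![(a : ℂ), b - g * Complex.I; b + g * Complex.I, d]).trace =
      (lightconePhase a d b g q : ℂ) := by
  simp only [Pd, Matrix.trace_fin_two, Matrix.smul_mul, Matrix.smul_apply, Matrix.mul_apply,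
    Fin.sum_univ_two, lightconePhase]
  simp
  linear_combination (-g * q 1 : ℂ) * Complex.I_sq

/-- Complex linear combinations of the first moments of the Laplace transform. -/
theorem integral_exp_trace_mul_lightconePhase {a d b g : ℝ} (ha : 0 < a)
    (hD : 0 < a * d - b ^ 2 - g ^ 2) {P : EuclideanSpace ℝ (Fin 3) → ℂ}
    (a₁ d₁ b₁ g₁ a₂ d₂ b₂ g₂ : ℝ)
    (hP : ∀ q, P q = lightconePhase a₁ d₁ b₁ g₁ q + lightconePhase a₂ d₂ b₂ g₂ q * Complex.I) :
    Integrable (fun q => Complex.exp (-(Pd q *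
        !![(a : ℂ), b - g * Complex.I; b + g * Complex.I, d]).trace) * P q /
        ((2 * ‖q‖ : ℝ) : ℂ)) ∧
      ∫ q, Complex.exp (-(Pd q *
        !![(a : ℂ), b - g * Complex.I; b + g * Complex.I, d]).trace) * P q /
        ((2 * ‖q‖ : ℝ) : ℂ) =
      -(2 * Real.pi * ((a₁ * d + a * d₁ - 2 * b * b₁ - 2 * g * g₁) +
        (a₂ * d + a * d₂ - 2 * b * b₂ - 2 * g * g₂) * Complex.I)) /
          (a * d - b ^ 2 - g ^ 2) ^ 2 := by
  obtain ⟨i₁, v₁⟩ := lightconePhase_mul_exp ha hD a₁ d₁ b₁ g₁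
  obtain ⟨i₂, v₂⟩ := lightconePhase_mul_exp ha hD a₂ d₂ b₂ g₂
  have e : (fun q => Complex.exp (-(Pd q *
        !![(a : ℂ), b - g * Complex.I; b + g * Complex.I, d]).trace) * P q /
        ((2 * ‖q‖ : ℝ) : ℂ)) = fun q =>
      ((Real.exp (lightconePhase a d b g q) / (2 * ‖q‖) * lightconePhase a₁ d₁ b₁ g₁ q : ℝ) : ℂ) +
      ((Real.exp (lightconePhase a d b g q) / (2 * ‖q‖) * lightconePhase a₂ d₂ b₂ g₂ q : ℝ) : ℂ) *
        Complex.I := by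
    funext q
    rw [neg_trace_Pd_mul, hP]
    push_cast
    ring
  rw [e]
  refine ⟨i₁.ofReal.add (i₂.ofReal.mul_const _), ?_⟩
  rw [integral_add i₁.ofReal (i₂.ofReal.mul_const _), integral_mul_const, integral_complex_ofReal,
    integral_complex_ofReal, v₁, v₂]
  push_cast
  ring

/-- Matrix-valued Laplace transform identity (Lemma 4.2 for `n = 1`): there is
`C > 0` such that for every positive definite Hermitian `Y`,
`∫ e^{−Tr(P†Y)} P† dμ₀(p) = C (det Y)⁻¹ Y⁻¹` with entrywise absolutely
convergent integrals. -/
theorem matrix_laplace_transform_lightcone :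
    ∃ C : ℝ, 0 < C ∧ ∀ Y : Matrix (Fin 2) (Fin 2) ℂ, Y.PosDef →
      (∀ i j : Fin 2, Integrable (fun q : EuclideanSpace ℝ (Fin 3) =>
        Complex.exp (-((Pd q * Y).trace)) * Pd q i j / ((2 * ‖q‖ : ℝ) : ℂ))) ∧
      (Matrix.of fun i j : Fin 2 => ∫ q : EuclideanSpace ℝ (Fin 3),
          Complex.exp (-((Pd q * Y).trace)) * Pd q i j / ((2 * ‖q‖ : ℝ) : ℂ))
        = (C : ℂ) • (Y.det⁻¹ • Y⁻¹) := by
  refine ⟨2 * Real.pi, by positivity, fun Y hY => ?_⟩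
  obtain ⟨a, d, b, g, ha, hD, rfl⟩ := hY.exists_eq_fin_two
  obtain ⟨i00, v00⟩ := integral_exp_trace_mul_lightconePhase ha hD (P := fun q => Pd q 0 0)
    (-1) 0 0 0 0 0 0 0 (fun q => by simp [Pd, lightconePhase]; ring)
  obtain ⟨i01, v01⟩ := integral_exp_trace_mul_lightconePhase ha hD (P := fun q => Pd q 0 1)
    0 0 (-1 / 2) 0 0 0 0 (1 / 2) (fun q => by simp [Pd, lightconePhase]; ring)
  obtain ⟨i10, v10⟩ := integral_exp_trace_mul_lightconePhase ha hD (P := fun q => Pd q 1 0)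
    0 0 (-1 / 2) 0 0 0 0 (-1 / 2) (fun q => by simp [Pd, lightconePhase]; ring)
  obtain ⟨i11, v11⟩ := integral_exp_trace_mul_lightconePhase ha hD (P := fun q => Pd q 1 1)
    0 (-1) 0 0 0 0 0 0 (fun q => by simp [Pd, lightconePhase]; ring)
  have hdet : (!![(a : ℂ), b - g * Complex.I; b + g * Complex.I, d]).det =
      a * d - b ^ 2 - g ^ 2 := by
    rw [Matrix.det_fin_two_of]
    linear_combination (g ^ 2 : ℂ) * Complex.I_sq
  refine ⟨fun i j => ?_, ?_⟩
  · fin_cases i <;> fin_cases j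
    exacts [i00, i01, i10, i11]
  · rw [Matrix.inv_def, hdet, Ring.inverse_eq_inv', Matrix.adjugate_fin_two_of]
    ext i j
    fin_cases i <;> fin_cases j
    · refine v00.trans ?_
      generalize (a * d - b ^ 2 - g ^ 2 : ℂ) = D
      simp
      ring
    · refine v01.trans ?_
      generalize (a * d - b ^ 2 - g ^ 2 : ℂ) = D
      simp
      ring
    · refine v10.trans ?_
      generalize (a * d - b ^ 2 - g ^ 2 : ℂ) = D
      simp
      ring
    · refine v11.trans ?_
      generalize (a * d - b ^ 2 - g ^ 2 : ℂ) = D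
      simp
      ring
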